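/- If ℵ₁ < cov(M), then there exists an independent family B on ω separating points such that nwd(X(B)) does not satisfy the Category Dichotomy: nwd(X(B)) ≰_K nwd, and ED ≰_K nwd(X(B))↾Y for every Y ∈ nwd(X(B))⁺. -/

import Mathlib

open Cardinal Set

/-- An ideal on a (countably infinite) set: contains finite sets, not the whole set,
closed under subsets and finite unions. -/
def IsIdeal {α : Type*} (I : Set (Set α)) : Prop :=
  (∀ A : Set α, A.Finite → A ∈ I) ∧ (Set.univ ∉ I) ∧
    (∀ A B : Set α, A ∈ I → B ⊆ A → B ∈ I) ∧
    (∀ A B : Set α, A ∈ I → B ∈ I → A ∪ B ∈ I)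

/-- `J ≤_K I`: there is a function from the underlying set of `I` to that of `J`
pulling members of `J` back into `I`. -/
def KatetovLE {α β : Type*} (J : Set (Set β)) (I : Set (Set α)) : Prop :=
  ∃ f : α → β, ∀ A ∈ J, f ⁻¹' A ∈ I

def FiniteToOne {α β : Type*} (f : α → β) : Prop := ∀ b : β, (f ⁻¹' {b}).Finite

/-- `J ≤_KB I`: Katětov-Blass order (finite-to-one witness). -/
def KatetovBlassLE {α β : Type*} (J : Set (Set β)) (I : Set (Set α)) : Prop :=
  ∃ f : α → β, FiniteToOne f ∧ ∀ A ∈ J, f ⁻¹' A ∈ I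

/-- The restriction `I ↾ X`, as an ideal on the subtype `X`. -/
def restrictIdeal {α : Type*} (I : Set (Set α)) (X : Set α) : Set (Set ↥X) :=
  {A : Set ↥X | (Subtype.val '' A) ∈ I}

/-- The ideal generated by a family `G` together with the finite sets. -/
def genIdeal {α : Type*} (G : Set (Set α)) : Set (Set α) :=
  {A | ∃ (S : Finset (Set α)) (F : Set α), ↑S ⊆ G ∧ F.Finite ∧ A ⊆ F ∪ ⋃₀ ↑S}

/-- Generators of the eventually different ideal: columns and graphs of functions. -/
def EDGenerators : Set (Set (ℕ × ℕ)) :=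
  {C | ∃ n : ℕ, C = {p : ℕ × ℕ | p.1 = n}} ∪
    {G | ∃ f : ℕ → ℕ, G = {p : ℕ × ℕ | p.2 = f p.1}}

/-- The eventually different ideal on `ω × ω`. -/
def ED : Set (Set (ℕ × ℕ)) := genIdeal EDGenerators

/-- Generators of `fin × fin`: columns and regions under graphs. -/
def FinFinGenerators : Set (Set (ℕ × ℕ)) :=
  {C | ∃ n : ℕ, C = {p : ℕ × ℕ | p.1 = n}} ∪
    {D | ∃ f : ℕ → ℕ, D = {p : ℕ × ℕ | p.2 ≤ f p.1}}

/-- The ideal `fin × fin` on `ω × ω`. -/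
def FinTimesFin : Set (Set (ℕ × ℕ)) := genIdeal FinFinGenerators

def Delta : Set (ℕ × ℕ) := {p : ℕ × ℕ | p.2 ≤ p.1}

/-- `ED_fin`, the restriction of `ED` to `Δ = {(n,m) : m ≤ n}`. -/
def EDfin : Set (Set ↥Delta) := restrictIdeal ED Delta

/-- The ideal of nowhere dense subsets of the rationals. -/
def nwdQ : Set (Set ℚ) := {A : Set ℚ | IsNowhereDense A}

/-- The copy of a family of subsets of `α` inside the Cantor space `α → Bool`
(via characteristic functions). -/
def cantorCopy {α : Type*} (I : Set (Set α)) : Set (α → Bool) :=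
  {x : α → Bool | {a : α | x a = true} ∈ I}

def IsUltrafilterSet (U : Set (Set ℕ)) : Prop :=
  Set.univ ∈ U ∧ ∅ ∉ U ∧ (∀ A B : Set ℕ, A ∈ U → A ⊆ B → B ∈ U) ∧
    (∀ A B : Set ℕ, A ∈ U → B ∈ U → A ∩ B ∈ U) ∧
    (∀ A : Set ℕ, A ∈ U ∨ (Set.univ \ A) ∈ U)

def NonprincipalUF (U : Set (Set ℕ)) : Prop := ∀ A : Set ℕ, A.Finite → A ∉ U

/-- The dual ideal `U*` of an ultrafilter `U`. -/
def dualIdeal (U : Set (Set ℕ)) : Set (Set ℕ) := {A : Set ℕ | Set.univ \ A ∈ U}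

/-- `U` is a Ramsey ultrafilter. -/
def IsRamseyUF (U : Set (Set ℕ)) : Prop :=
  ∀ P : ℕ → Set ℕ, Pairwise (Function.onFun Disjoint P) → (⋃ n, P n) = Set.univ →
    (∀ n, P n ∉ U) → ∃ A ∈ U, ∀ n, (A ∩ P n).Subsingleton

def IsTight (I : Set (Set ℕ)) : Prop :=
  ∀ X : ℕ → Set ℕ, (∀ n, X n ∉ I) → ∃ Y ∈ I, ∀ n, (Y ∩ X n).Infinite

def IsPIdeal (I : Set (Set ℕ)) : Prop :=
  ∀ A : ℕ → Set ℕ, (∀ n, A n ∈ I) → ∃ B ∈ I, ∀ n, (A n \ B).Finite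

def IsPMinus (I : Set (Set ℕ)) : Prop :=
  ∀ X : Set ℕ, X ∉ I → ∀ Xs : ℕ → Set ℕ, (∀ n, Xs n ⊆ X) → (∀ n, X \ Xs n ∈ I) →
    ∃ Y : Set ℕ, Y ∉ I ∧ ∀ n, (Y \ Xs n).Finite

def IsQPlus (I : Set (Set ℕ)) : Prop :=
  ∀ X : Set ℕ, X ∉ I → ∀ P : ℕ → Set ℕ, (∀ n, (P n).Finite) →
    Pairwise (Function.onFun Disjoint P) → (⋃ n, P n) = X →
    ∃ A : Set ℕ, A ∉ I ∧ A ⊆ X ∧ ∀ n, (A ∩ P n).Subsingleton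

def AlmostSubset (A B : Set ℕ) : Prop := (A \ B).Finite

/-- The tower number 𝔱. -/
noncomputable def towerNumber : Cardinal :=
  sInf {c : Cardinal | ∃ T : Set (Set ℕ),
    (∀ A ∈ T, A.Infinite) ∧
    (∀ A ∈ T, ∀ B ∈ T, AlmostSubset A B ∨ AlmostSubset B A) ∧
    (¬ ∃ A : Set ℕ, A.Infinite ∧ ∀ B ∈ T, AlmostSubset A B) ∧
    Cardinal.mk T = c}

/-- cov(M): covering number of the meager ideal of Baire space. -/
noncomputable def covM : Cardinal :=
  sInf {c : Cardinal | ∃ F : Set (Set (ℕ → ℕ)),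
    (∀ A ∈ F, IsMeagre A) ∧ ⋃₀ F = Set.univ ∧ Cardinal.mk F = c}

/-- The dominating number 𝔡. -/
noncomputable def dNumber : Cardinal :=
  sInf {c : Cardinal | ∃ D : Set (ℕ → ℕ),
    (∀ f : ℕ → ℕ, ∃ g ∈ D, ∀ᶠ n in Filter.atTop, f n ≤ g n) ∧ Cardinal.mk D = c}

/-- The cofinality of an ideal: least size of a cofinal subfamily. -/
noncomputable def idealCof (I : Set (Set ℕ)) : Cardinal :=
  sInf {c : Cardinal | ∃ C : Set (Set ℕ), C ⊆ I ∧ (∀ A ∈ I, ∃ B ∈ C, A ⊆ B) ∧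
    Cardinal.mk C = c}

/-- An increasing interval partition of ω, given by its sequence of endpoints. -/
structure IncIntervalPartition where
  e : ℕ → ℕ
  zero : e 0 = 0
  mono : StrictMono e
  incr : ∀ n : ℕ, e (n + 1) - e n < e (n + 2) - e (n + 1)

def IncIntervalPartition.block (P : IncIntervalPartition) (n : ℕ) : Set ℕ :=
  Set.Ico (P.e n) (P.e (n + 1))

/-- A selector of an interval partition: a set meeting each block in exactly one point. -/
def IsSelector (P : IncIntervalPartition) (S : Set ℕ) : Prop :=
  ∀ n : ℕ, ∃! x : ℕ, x ∈ S ∩ P.block n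

/-- The ideal `ED_P` generated by the selectors of `P` (and the finite sets). -/
def EDP (P : IncIntervalPartition) : Set (Set ℕ) := genIdeal {S : Set ℕ | IsSelector P S}

/-- A Fréchet space: closure points are limits of sequences. -/
def IsFrechet (α : Type*) [TopologicalSpace α] : Prop :=
  ∀ (a : α) (Y : Set α), a ∈ closure Y →
    ∃ u : ℕ → α, (∀ n, u n ∈ Y) ∧ Filter.Tendsto u Filter.atTop (nhds a)

/-- Zero-dimensional: the clopen sets form a basis. -/
def ZeroDimensional (α : Type*) [TopologicalSpace α] : Prop :=
  TopologicalSpace.IsTopologicalBasis {U : Set α | IsClopen U}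

/-- A local π-base at a point. -/
def IsLocalPiBase {α : Type*} [TopologicalSpace α] (B : Set (Set α)) (b : α) : Prop :=
  (∀ U ∈ B, IsOpen U ∧ U.Nonempty) ∧
    ∀ V : Set α, IsOpen V → b ∈ V → ∃ U ∈ B, U ⊆ V

/-- Every point has uncountable π-character. -/
def UncountablePiCharEverywhere (α : Type*) [TopologicalSpace α] : Prop :=
  ∀ (b : α) (B : Set (Set α)), IsLocalPiBase B b → ¬ B.Countable

/-- An independent family on ω. -/
def IsIndepFamily (B : Set (Set ℕ)) : Prop :=
  (∀ A ∈ B, A.Infinite) ∧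
    ∀ F G : Finset (Set ℕ), ↑F ⊆ B → ↑G ⊆ B → Disjoint F G →
      ((⋂ A ∈ F, A) ∩ ⋂ A ∈ G, (Set.univ \ A)).Infinite

def SeparatesPointsFam (B : Set (Set ℕ)) : Prop :=
  ∀ m n : ℕ, m ≠ n → ∃ A ∈ B, m ∈ A ∧ n ∉ A

/-- The envelope of an independent family: finite Boolean combinations. -/
def envSets (B : Set (Set ℕ)) : Set (Set ℕ) :=
  {V : Set ℕ | ∃ F G : Finset (Set ℕ), ↑F ⊆ B ∧ ↑G ⊆ B ∧ Disjoint F G ∧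
    V = (⋂ A ∈ F, A) ∩ ⋂ A ∈ G, (Set.univ \ A)}

/-- The topology on ω generated by the envelope of `B`. -/
def XBtop (B : Set (Set ℕ)) : TopologicalSpace ℕ :=
  TopologicalSpace.generateFrom (envSets B)

/-- The ideal of nowhere dense subsets of the space `X(B)`. -/
def nwdXB (B : Set (Set ℕ)) : Set (Set ℕ) :=
  {A : Set ℕ | @IsNowhereDense ℕ (XBtop B) A}

/-- `non*(ED_fin)`. -/
noncomputable def nonStarEDfin : Cardinal :=
  sInf {c : Cardinal | ∃ H : Set (Set ↥Delta),
    (∀ A ∈ H, A.Infinite) ∧ (∀ A ∈ EDfin, ∃ B ∈ H, (A ∩ B).Finite) ∧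
    Cardinal.mk H = c}

section CategoryDichotomy

/-- The Boolean combination determined by two finite families of sets. -/
def boolComb (F G : Finset (Set ℕ)) : Set ℕ :=
  (⋂ A ∈ F, A) ∩ ⋂ A ∈ G, (Set.univ \ A)

theorem mem_boolComb {F G : Finset (Set ℕ)} {x : ℕ} :
    x ∈ boolComb F G ↔ (∀ A ∈ F, x ∈ A) ∧ ∀ A ∈ G, x ∉ A := by
  simp [boolComb]

theorem mem_envSets {B : Set (Set ℕ)} {V : Set ℕ} :
    V ∈ envSets B ↔ ∃ F G : Finset (Set ℕ), ↑F ⊆ B ∧ ↑G ⊆ B ∧ Disjoint F G ∧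
      V = boolComb F G := Iff.rfl

theorem disjoint_of_mem_boolComb {F G : Finset (Set ℕ)} {x : ℕ}
    (hF : ∀ A ∈ F, x ∈ A) (hG : ∀ A ∈ G, x ∉ A) : Disjoint F G :=
  Finset.disjoint_left.2 fun A h1 h2 => hG A h2 (hF A h1)

theorem IsIndepFamily.infinite_of_mem_envSets {B : Set (Set ℕ)} (hB : IsIndepFamily B)
    {V : Set ℕ} (hV : V ∈ envSets B) : V.Infinite := by
  obtain ⟨F, G, hF, hG, hd, rfl⟩ := hV
  exact hB.2 F G hF hG hd

theorem isTopologicalBasis_envSets (B : Set (Set ℕ)) :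
    @TopologicalSpace.IsTopologicalBasis ℕ (XBtop B) (envSets B) := by
  classical
  refine @TopologicalSpace.IsTopologicalBasis.mk ℕ (XBtop B) _ ?_ ?_ rfl
  · rintro _ ⟨F, G, hF, hG, -, rfl⟩ _ ⟨F', G', hF', hG', -, rfl⟩ x hx
    change x ∈ boolComb F G ∩ boolComb F' G' at hx
    obtain ⟨⟨h1, h2⟩, h3, h4⟩ := And.imp mem_boolComb.1 mem_boolComb.1 hx
    have h5 : ∀ A ∈ F ∪ F', x ∈ A := fun A hA =>
      (Finset.mem_union.1 hA).elim (h1 A) (h3 A)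
    have h6 : ∀ A ∈ G ∪ G', x ∉ A := fun A hA =>
      (Finset.mem_union.1 hA).elim (h2 A) (h4 A)
    refine ⟨boolComb (F ∪ F') (G ∪ G'), mem_envSets.2 ⟨_, _, ?_, ?_,
      disjoint_of_mem_boolComb h5 h6, rfl⟩, mem_boolComb.2 ⟨h5, h6⟩, fun y hy => ?_⟩
    · rw [Finset.coe_union]; exact Set.union_subset hF hF'
    · rw [Finset.coe_union]; exact Set.union_subset hG hG'
    · obtain ⟨h7, h8⟩ := mem_boolComb.1 hy
      exact ⟨mem_boolComb.2 ⟨fun A hA => h7 A (Finset.mem_union_left _ hA),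
          fun A hA => h8 A (Finset.mem_union_left _ hA)⟩,
        mem_boolComb.2 ⟨fun A hA => h7 A (Finset.mem_union_right _ hA),
          fun A hA => h8 A (Finset.mem_union_right _ hA)⟩⟩
  · refine Set.eq_univ_of_forall fun x => ⟨boolComb ∅ ∅, mem_envSets.2 ⟨∅, ∅, ?_⟩, ?_⟩
    · simp
    · simp [mem_boolComb]

theorem TopologicalSpace.IsTopologicalBasis.isNowhereDense_iff {α : Type*} [TopologicalSpace α]
    {b : Set (Set α)} (hb : TopologicalSpace.IsTopologicalBasis b) (hne : ∀ W ∈ b, W.Nonempty)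
    {A : Set α} :
    IsNowhereDense A ↔ ∀ W ∈ b, ∃ W' ∈ b, W' ⊆ W ∧ Disjoint W' A := by
  constructor
  · intro hA W hW
    have : ¬ W ⊆ closure A := fun hWA => by
      obtain ⟨x, hx⟩ := hne W hW
      have hx' := interior_maximal hWA (hb.isOpen hW) hx
      rw [hA] at hx'
      exact hx'
    obtain ⟨x, hxW, hxA⟩ := Set.not_subset.1 this
    obtain ⟨W', hW', -, hsub⟩ := hb.exists_subset_of_mem_open (u := W ∩ (closure A)ᶜ)
      ⟨hxW, hxA⟩ ((hb.isOpen hW).inter isClosed_closure.isOpen_compl)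
    refine ⟨W', hW', fun y hy => (hsub hy).1, Set.disjoint_left.2 fun y hy hyA => ?_⟩
    exact (hsub hy).2 (subset_closure hyA)
  · intro h
    refine Set.eq_empty_of_forall_notMem fun x hx => ?_
    obtain ⟨W, hW, -, hsub⟩ := hb.exists_subset_of_mem_open hx isOpen_interior
    obtain ⟨W', hW', hWW, hd⟩ := h W hW
    obtain ⟨y, hy⟩ := hne W' hW'
    obtain ⟨z, hz, hzA⟩ := _root_.mem_closure_iff.1 (interior_subset (hsub (hWW hy))) W'
      (hb.isOpen hW') hy
    exact Set.disjoint_left.1 hd hz hzA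

theorem IsIndepFamily.mem_nwdXB_iff {B : Set (Set ℕ)} (hB : IsIndepFamily B) {A : Set ℕ} :
    A ∈ nwdXB B ↔ ∀ W ∈ envSets B, ∃ W' ∈ envSets B, W' ⊆ W ∧ Disjoint W' A :=
  @TopologicalSpace.IsTopologicalBasis.isNowhereDense_iff ℕ (XBtop B) (envSets B)
    (isTopologicalBasis_envSets B) (fun _ hW => (hB.infinite_of_mem_envSets hW).nonempty) A

theorem exists_envSets_disjoint_finite {B : Set (Set ℕ)} (hB : IsIndepFamily B)
    (hs : SeparatesPointsFam B) {S : Set ℕ} (hS : S.Finite) :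
    ∀ W ∈ envSets B, ∃ W' ∈ envSets B, W' ⊆ W ∧ Disjoint W' S := by
  classical
  induction S, hS using Set.Finite.induction_on with
  | empty => exact fun W hW => ⟨W, hW, subset_rfl, Set.disjoint_empty W⟩
  | @insert n S _ _ ih =>
    intro W hW
    obtain ⟨V, hV, hVW, hVS⟩ := ih W hW
    obtain ⟨m, hmV, hmn⟩ := (hB.infinite_of_mem_envSets hV).exists_notMem_finite
      (Set.finite_singleton n)
    obtain ⟨X, hXB, hmX, hnX⟩ := hs m n hmn
    obtain ⟨F, G, hF, hG, -, rfl⟩ := mem_envSets.1 hV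
    obtain ⟨h1, h2⟩ := mem_boolComb.1 hmV
    have h3 : ∀ A ∈ insert X F, m ∈ A := fun A hA => by
      rcases Finset.mem_insert.1 hA with rfl | hA
      exacts [hmX, h1 A hA]
    have hsub : boolComb (insert X F) G ⊆ boolComb F G := fun y hy => by
      obtain ⟨h4, h5⟩ := mem_boolComb.1 hy
      exact mem_boolComb.2 ⟨fun A hA => h4 A (Finset.mem_insert_of_mem hA), h5⟩
    refine ⟨boolComb (insert X F) G, mem_envSets.2 ⟨_, G, ?_, hG,
      disjoint_of_mem_boolComb h3 h2, rfl⟩, hsub.trans hVW, ?_⟩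
    · rw [Finset.coe_insert]; exact Set.insert_subset hXB hF
    · refine Set.disjoint_insert_right.2 ⟨fun hn => hnX ?_, hVS.mono_left hsub⟩
      exact (mem_boolComb.1 hn).1 X (Finset.mem_insert_self _ _)

/-- For an uncountable independent family `B`, any sequence of non-nowhere dense sets of `X(B)`
admits a nowhere dense set of representatives. -/
theorem exists_nwdXB_inter_nonempty {B : Set (Set ℕ)} (hB : IsIndepFamily B)
    (hs : SeparatesPointsFam B) (hunc : ¬ B.Countable) (D : ℕ → Set ℕ)
    (hD : ∀ n, D n ∉ nwdXB B) : ∃ A ∈ nwdXB B, ∀ n, (A ∩ D n).Nonempty := by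
  classical
  have key : ∀ n, ∃ F G : Finset (Set ℕ), ↑F ⊆ B ∧ ↑G ⊆ B ∧ Disjoint F G ∧
      ∀ W' ∈ envSets B, W' ⊆ boolComb F G → (W' ∩ D n).Nonempty := by
    intro n
    have := hD n
    rw [hB.mem_nwdXB_iff] at this
    push Not at this
    obtain ⟨W, hW, h⟩ := this
    obtain ⟨F, G, hF, hG, hd, rfl⟩ := mem_envSets.1 hW
    exact ⟨F, G, hF, hG, hd, fun W' hW' hsub => Set.not_disjoint_iff_nonempty_inter.1
      (h W' hW' hsub)⟩
  choose F G hF hG hd h using key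
  have hC : (⋃ n, (↑(F n ∪ G n) : Set (Set ℕ))).Countable :=
    Set.countable_iUnion fun n => (F n ∪ G n).countable_toSet
  have hinf : (B \ ⋃ n, (↑(F n ∪ G n) : Set (Set ℕ))).Infinite := fun hfin =>
    hunc ((hfin.countable.union hC).mono fun x hx => by
      by_cases hx' : x ∈ ⋃ n, (↑(F n ∪ G n) : Set (Set ℕ))
      exacts [Or.inr hx', Or.inl ⟨hx, hx'⟩])
  let α := hinf.natEmbedding
  have hα : ∀ i n, (α i : Set ℕ) ∉ F n ∪ G n := fun i n hi =>
    (α i).2.2 (Set.mem_iUnion.2 ⟨n, hi⟩)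
  have hex : ∀ n, ∃ a ∈ D n, ∀ i ≤ n, a ∈ (α i : Set ℕ) := by
    intro n
    let H : Finset (Set ℕ) := (Finset.range (n + 1)).image fun i => (α i : Set ℕ)
    have hH : ∀ A ∈ H, ∃ i, (α i : Set ℕ) = A := fun A hA => by
      obtain ⟨i, -, hi⟩ := Finset.mem_image.1 hA
      exact ⟨i, hi⟩
    obtain ⟨a, ha, haD⟩ := h n (boolComb (F n ∪ H) (G n)) (mem_envSets.2 ⟨_, _, by
        rw [Finset.coe_union]
        refine Set.union_subset (hF n) fun A hA => ?_
        obtain ⟨i, rfl⟩ := hH A hA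
        exact (α i).2.1, hG n, by
        refine Finset.disjoint_union_left.2 ⟨hd n, Finset.disjoint_left.2 fun A hA hA' => ?_⟩
        obtain ⟨i, rfl⟩ := hH A hA
        exact hα i n (Finset.mem_union_right _ hA'), rfl⟩) (fun y hy => by
        obtain ⟨h1, h2⟩ := mem_boolComb.1 hy
        exact mem_boolComb.2 ⟨fun A hA => h1 A (Finset.mem_union_left _ hA), h2⟩)
    refine ⟨a, haD, fun i hi => (mem_boolComb.1 ha).1 _ (Finset.mem_union_right _ ?_)⟩
    exact Finset.mem_image.2 ⟨i, Finset.mem_range.2 (Nat.lt_succ_of_le hi), rfl⟩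
  choose a haD ha using hex
  refine ⟨Set.range a, hB.mem_nwdXB_iff.2 fun W hW => ?_, fun n => ⟨a n, ⟨n, rfl⟩, haD n⟩⟩
  obtain ⟨P, Q, hP, hQ, hPQ, rfl⟩ := mem_envSets.1 hW
  obtain ⟨i, hi⟩ : ∃ i, (α i : Set ℕ) ∉ P := by
    by_contra! hcon
    exact Set.infinite_of_injective_forall_mem (f := fun i => (α i : Set ℕ))
      (Subtype.val_injective.comp α.injective) hcon P.finite_toSet
  obtain ⟨W', hW', hsub, hdisj⟩ := exists_envSets_disjoint_finite hB hs
    ((Set.finite_lt_nat i).image a) (boolComb P (insert (α i : Set ℕ) Q)) (mem_envSets.2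
      ⟨P, _, hP, by rw [Finset.coe_insert]; exact Set.insert_subset (α i).2.1 hQ,
        Finset.disjoint_insert_right.2 ⟨hi, hPQ⟩, rfl⟩)
  refine ⟨W', hW', hsub.trans fun y hy => ?_, Set.disjoint_left.2 ?_⟩
  · obtain ⟨h1, h2⟩ := mem_boolComb.1 hy
    exact mem_boolComb.2 ⟨h1, fun A hA => h2 A (Finset.mem_insert_of_mem hA)⟩
  · rintro _ hy ⟨n, rfl⟩
    by_cases hn : n < i
    · exact Set.disjoint_left.1 hdisj hy ⟨n, hn, rfl⟩
    · exact (mem_boolComb.1 (hsub hy)).2 _ (Finset.mem_insert_self _ _) (ha n i (not_lt.1 hn))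

theorem not_katetovLE_nwdXB_nwdQ {B : Set (Set ℕ)} (hB : IsIndepFamily B)
    (hs : SeparatesPointsFam B) (hunc : ¬ B.Countable) : ¬ KatetovLE (nwdXB B) nwdQ := by
  rintro ⟨f, hf⟩
  have hbasis := TopologicalSpace.isBasis_countableBasis ℚ
  obtain ⟨U, hU⟩ := (TopologicalSpace.countable_countableBasis ℚ).exists_eq_range
    (by
      obtain ⟨v, hv, -⟩ := hbasis.exists_subset_of_mem_open (Set.mem_univ (0 : ℚ)) isOpen_univ
      exact ⟨v, hv⟩)
  have hmem : ∀ n, U n ∈ TopologicalSpace.countableBasis ℚ := fun n => hU ▸ Set.mem_range_self n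
  obtain ⟨A, hA, hAD⟩ := exists_nwdXB_inter_nonempty hB hs hunc (fun n => f '' U n) (by
    intro n hn
    have h1 : IsNowhereDense (U n) :=
      (hf _ hn : IsNowhereDense _).mono (Set.subset_preimage_image f _)
    have h2 := interior_maximal subset_closure
      (TopologicalSpace.isOpen_of_mem_countableBasis (hmem n))
    rw [h1] at h2
    exact TopologicalSpace.nonempty_of_mem_countableBasis (hmem n) |>.ne_empty
      (Set.subset_empty_iff.1 h2))
  have hd : Dense (f ⁻¹' A) := hbasis.dense_iff.2 fun o ho _ => by
    rw [hU] at ho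
    obtain ⟨n, rfl⟩ := ho
    obtain ⟨_, haA, q, hq, rfl⟩ := hAD n
    exact ⟨q, hq, haA⟩
  have h3 : interior (closure (f ⁻¹' A)) = ∅ := hf A hA
  rw [hd.closure_eq, interior_univ] at h3
  exact Set.empty_ne_univ h3.symm

theorem exists_forall_mem_of_mk_lt_covM {ι : Type} (hι : Cardinal.mk ι < covM)
    (O : ι → Set (ℕ → ℕ)) (ho : ∀ i, IsOpen (O i)) (hd : ∀ i, Dense (O i)) :
    ∃ g, ∀ i, g ∈ O i := by
  by_contra! hcon
  refine (Cardinal.mk_range_le (f := fun i => (O i)ᶜ)).not_gt (hι.trans_le ?_)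
  refine csInf_le' ⟨_, ?_, ?_, rfl⟩
  · rintro _ ⟨i, rfl⟩
    exact ((isClosed_isNowhereDense_iff_compl.2
      (by simpa using ⟨ho i, hd i⟩)).2).isMeagre
  · refine Set.eq_univ_of_forall fun g => ?_
    obtain ⟨i, hi⟩ := hcon g
    exact ⟨_, ⟨i, rfl⟩, hi⟩

theorem isOpen_setOf_exists_mem_graph (P : Set (ℕ × ℕ)) :
    IsOpen {g : ℕ → ℕ | ∃ p ∈ P, g p.1 = p.2} := by
  have : {g : ℕ → ℕ | ∃ p ∈ P, g p.1 = p.2} = ⋃ p ∈ P, (fun g : ℕ → ℕ => g p.1) ⁻¹' {p.2} := by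
    ext g; simp
  rw [this]
  exact isOpen_biUnion fun p _ => (isOpen_discrete _).preimage (continuous_apply p.1)

theorem dense_setOf_exists_mem_graph {P : Set (ℕ × ℕ)} (hP : ∀ n, ∃ p ∈ P, n ≤ p.1) :
    Dense {g : ℕ → ℕ | ∃ p ∈ P, g p.1 = p.2} := by
  classical
  refine dense_iff_inter_open.2 fun V hV ⟨g, hg⟩ => ?_
  obtain ⟨I, u, hu, hsub⟩ := isOpen_pi_iff.1 hV g hg
  obtain ⟨p, hp, hle⟩ := hP (I.sup id + 1)
  refine ⟨Function.update g p.1 p.2, hsub fun i hi => ?_, p, hp, by simp⟩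
  have hi' : i ≤ I.sup id := Finset.le_sup (f := id) hi
  rw [Function.update_of_ne (by omega)]
  exact (hu i hi).2

theorem mem_ED_graph (g : ℕ → ℕ) : {p : ℕ × ℕ | p.2 = g p.1} ∈ ED :=
  ⟨{{p : ℕ × ℕ | p.2 = g p.1}}, ∅, by
    simpa [EDGenerators] using Or.inr ⟨g, rfl⟩, Set.finite_empty, by simp⟩

theorem mem_ED_columns_lt (n : ℕ) : {p : ℕ × ℕ | p.1 < n} ∈ ED := by
  classical
  refine ⟨(Finset.range n).image fun k => {p : ℕ × ℕ | p.1 = k}, ∅, ?_, Set.finite_empty, ?_⟩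
  · intro C hC
    obtain ⟨k, -, rfl⟩ := Finset.mem_image.1 hC
    exact Or.inl ⟨k, rfl⟩
  · intro p hp
    exact Or.inr ⟨{q : ℕ × ℕ | q.1 = p.1},
      Finset.mem_image.2 ⟨p.1, Finset.mem_range.2 hp, rfl⟩, rfl⟩

theorem mk_envSets_le {B : Set (Set ℕ)} {κ : Cardinal} (hκ : Cardinal.aleph0 ≤ κ)
    (hB : Cardinal.mk B ≤ κ) : Cardinal.mk (envSets B) ≤ κ := by
  classical
  have hfin : Cardinal.mk (Finset B) ≤ κ := by
    rcases finite_or_infinite B with hf | hi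
    · exact (Cardinal.lt_aleph0_of_finite (Finset B)).le.trans hκ
    · rwa [Cardinal.mk_finset_of_infinite]
  have hsub : envSets B ⊆ Set.range fun q : Finset B × Finset B =>
      boolComb (q.1.image Subtype.val) (q.2.image Subtype.val) := by
    rintro _ ⟨F, G, hF, hG, -, rfl⟩
    have himg : ∀ H : Finset (Set ℕ), ↑H ⊆ B →
        ∃ K : Finset B, K.image Subtype.val = H := fun H hH =>
      ⟨H.subtype (· ∈ B), by
        ext x
        simpa using fun hx => hH hx⟩
    obtain ⟨F', rfl⟩ := himg F hF
    obtain ⟨G', rfl⟩ := himg G hG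
    exact ⟨(F', G'), rfl⟩
  refine (Cardinal.mk_le_mk_of_subset hsub).trans (Cardinal.mk_range_le.trans ?_)
  rw [Cardinal.mk_prod, Cardinal.lift_id]
  exact (mul_le_mul' hfin hfin).trans (Cardinal.mul_eq_self hκ).le

theorem not_katetovLE_ED_restrictIdeal {B : Set (Set ℕ)} (hB : IsIndepFamily B)
    (hcov : Cardinal.mk (envSets B) < covM) {Y : Set ℕ} (hY : Y ∉ nwdXB B) :
    ¬ KatetovLE ED (restrictIdeal (nwdXB B) Y) := by
  rintro ⟨f, hf⟩
  rw [hB.mem_nwdXB_iff] at hY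
  push Not at hY
  obtain ⟨W₀, hW₀, hY⟩ := hY
  have hcol : ∀ W ∈ envSets B, W ⊆ W₀ → ∀ n, ∃ y : Y, y.1 ∈ W ∧ n ≤ (f y).1 := by
    intro W hW hsub n
    obtain ⟨W', hW', hWW, hdisj⟩ := hB.mem_nwdXB_iff.1 (hf _ (mem_ED_columns_lt n)) W hW
    obtain ⟨y, hyW, hyY⟩ := Set.not_disjoint_iff.1 (hY W' hW' (hWW.trans hsub))
    exact ⟨⟨y, hyY⟩, hWW hyW, not_lt.1 fun hlt =>
      Set.disjoint_left.1 hdisj hyW ⟨⟨y, hyY⟩, hlt, rfl⟩⟩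
  let E := {W : envSets B // W.1 ⊆ W₀}
  let P : E → Set (ℕ × ℕ) := fun W => f '' {y | y.1 ∈ W.1.1}
  obtain ⟨g, hg⟩ := exists_forall_mem_of_mk_lt_covM (ι := E)
    ((Cardinal.mk_subtype_le _).trans_lt hcov)
    (fun W => {g : ℕ → ℕ | ∃ p ∈ P W, g p.1 = p.2})
    (fun W => isOpen_setOf_exists_mem_graph _) (fun W => dense_setOf_exists_mem_graph fun n => by
      obtain ⟨y, hy, hn⟩ := hcol W.1.1 W.1.2 W.2 n
      exact ⟨f y, ⟨y, hy, rfl⟩, hn⟩)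
  obtain ⟨W, hW, hsub, hdisj⟩ := hB.mem_nwdXB_iff.1 (hf _ (mem_ED_graph g)) W₀ hW₀
  obtain ⟨_, ⟨y, hy, rfl⟩, hgy⟩ := hg ⟨⟨W, hW⟩, hsub⟩
  exact Set.disjoint_left.1 hdisj hy ⟨y, hgy.symm, rfl⟩

/-- An indexed family of sets is independent if all its finite Boolean combinations with
disjoint index sets are infinite. -/
def IsIndexedIndep {ι T : Type*} (A : ι → Set T) : Prop :=
  ∀ F G : Finset ι, Disjoint F G → {t | (∀ i ∈ F, t ∈ A i) ∧ ∀ i ∈ G, t ∉ A i}.Infinite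

open Classical in
/-- The Fichtenholz–Kantorovich independent family of size continuum. -/
theorem isIndexedIndep_fichtenholz : IsIndexedIndep (fun x : Set ℕ =>
    {p : ℕ × Finset (Finset ℕ) | (Finset.range p.1).filter (· ∈ x) ∈ p.2}) := by
  intro F G hd
  have hsep : ∀ x y : Set ℕ, x ≠ y →
      ∃ N, ∀ n ≥ N, (Finset.range n).filter (· ∈ x) ≠ (Finset.range n).filter (· ∈ y) := by
    intro x y hxy
    obtain ⟨k, hk⟩ : ∃ k, ¬ (k ∈ x ↔ k ∈ y) := by
      by_contra! hcon
      exact hxy (Set.ext hcon)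
    refine ⟨k + 1, fun n hn heq => hk ?_⟩
    have := Finset.ext_iff.1 heq k
    simpa [show k < n by omega] using this
  choose! N hN using hsep
  let M := F.sup fun x => G.sup fun y => N x y
  have hM : ∀ x ∈ F, ∀ y ∈ G, N x y ≤ M := fun x hx y hy =>
    (Finset.le_sup (f := fun y => N x y) hy).trans
      (Finset.le_sup (f := fun x => G.sup fun y => N x y) hx)
  refine Set.infinite_of_injective_forall_mem (f := fun k : ℕ =>
    (M + k, F.image fun x => (Finset.range (M + k)).filter (· ∈ x))) ?_ ?_
  · intro a b hab
    simpa using congrArg Prod.fst hab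
  · refine fun k => ⟨fun x hx => Finset.mem_image.2 ⟨x, hx, rfl⟩, fun y hy hmem => ?_⟩
    obtain ⟨x, hx, hxy⟩ := Finset.mem_image.1 hmem
    have hne : x ≠ y := fun he => Finset.disjoint_left.1 hd hx (he ▸ hy)
    exact hN x y hne (M + k) ((hM x hx y hy).trans (Nat.le_add_right _ _)) hxy

namespace IsIndexedIndep

variable {ι κ T T' : Type*} {A : ι → Set T}

theorem preimage_equiv (hA : IsIndexedIndep A) (e : T' ≃ T) :
    IsIndexedIndep fun i => e ⁻¹' A i := fun F G hd =>
  (hA F G hd).preimage (f := e) (by simp)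

theorem comp_injective (hA : IsIndexedIndep A) {j : κ → ι} (hj : j.Injective) :
    IsIndexedIndep (A ∘ j) := by
  intro F G hd
  refine (hA (F.map ⟨j, hj⟩) (G.map ⟨j, hj⟩) ((Finset.disjoint_map _).2 hd)).mono fun t ht => ?_
  exact ⟨fun i hi => ht.1 _ (Finset.mem_map_of_mem ⟨j, hj⟩ hi),
    fun i hi => ht.2 _ (Finset.mem_map_of_mem ⟨j, hj⟩ hi)⟩

theorem of_finite_symmDiff (hA : IsIndexedIndep A) {A' : ι → Set T}
    (h : ∀ i, {t | ¬ (t ∈ A i ↔ t ∈ A' i)}.Finite) : IsIndexedIndep A' := by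
  classical
  intro F G hd
  have hfin : (⋃ i ∈ F ∪ G, {t | ¬ (t ∈ A i ↔ t ∈ A' i)}).Finite :=
    (F ∪ G).finite_toSet.biUnion fun i _ => h i
  refine ((hA F G hd).sdiff hfin).mono ?_
  rintro t ⟨ht, hn⟩
  have hiff : ∀ i ∈ F ∪ G, (t ∈ A i ↔ t ∈ A' i) := fun i hi => by
    by_contra hc
    exact hn (Set.mem_biUnion hi hc)
  exact ⟨fun i hi => (hiff i (Finset.mem_union_left _ hi)).1 (ht.1 i hi),
    fun i hi hc => ht.2 i hi ((hiff i (Finset.mem_union_right _ hi)).2 hc)⟩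

theorem injective (hA : IsIndexedIndep A) : A.Injective := by
  intro i k hik
  by_contra hne
  obtain ⟨t, h1, h2⟩ := (hA {i} {k} (Finset.disjoint_singleton.2 hne)).nonempty
  exact h2 k (Finset.mem_singleton_self k) (hik ▸ h1 i (Finset.mem_singleton_self i))

theorem isIndepFamily_range {A : ι → Set ℕ} (hA : IsIndexedIndep A) :
    IsIndepFamily (Set.range A) := by
  classical
  refine ⟨?_, fun F G hF hG hd => ?_⟩
  · rintro _ ⟨i, rfl⟩
    exact (hA {i} ∅ (Finset.disjoint_empty_right _)).mono fun t ht =>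
      ht.1 i (Finset.mem_singleton_self i)
  · have hpre : ∀ H : Finset (Set ℕ), ↑H ⊆ Set.range A → ∃ K : Finset ι, K.image A = H :=
      fun H hH => by
        obtain ⟨K, -, hK⟩ := Finset.subset_set_image_iff.1
          (show (↑H : Set (Set ℕ)) ⊆ A '' Set.univ by rwa [Set.image_univ])
        exact ⟨K, hK⟩
    obtain ⟨F', rfl⟩ := hpre F hF
    obtain ⟨G', rfl⟩ := hpre G hG
    refine (hA F' G' (Finset.disjoint_left.2 fun i h1 h2 => ?_)).mono fun t ht => ?_
    · exact Finset.disjoint_left.1 hd (Finset.mem_image_of_mem A h1)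
        (Finset.mem_image_of_mem A h2)
    · refine mem_boolComb.2 ⟨fun X hX => ?_, fun X hX => ?_⟩
      · obtain ⟨i, hi, rfl⟩ := Finset.mem_image.1 hX
        exact ht.1 i hi
      · obtain ⟨i, hi, rfl⟩ := Finset.mem_image.1 hX
        exact ht.2 i hi

/-- An infinite independent family can be modified by finite sets so that it separates points. -/
theorem exists_separatesPointsFam [Infinite ι] {A : ι → Set ℕ} (hA : IsIndexedIndep A) :
    ∃ A' : ι → Set ℕ, IsIndexedIndep A' ∧ SeparatesPointsFam (Set.range A') := by
  classical
  let j : ℕ ↪ ι := Infinite.natEmbedding ι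
  let A' : ι → Set ℕ := Function.extend j
    (fun k => insert k.unpair.1 (A (j k)) \ {k.unpair.2}) A
  have hj : ∀ k, A' (j k) = insert k.unpair.1 (A (j k)) \ {k.unpair.2} := fun k =>
    j.injective.extend_apply _ _ k
  refine ⟨A', hA.of_finite_symmDiff fun i => ?_, fun m n hmn => ?_⟩
  · by_cases hi : ∃ k, j k = i
    · obtain ⟨k, rfl⟩ := hi
      refine (Set.toFinite {k.unpair.1, k.unpair.2}).subset fun t ht => ?_
      by_contra hc
      simp only [Set.mem_insert_iff, Set.mem_singleton_iff, not_or] at hc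
      refine ht ?_
      rw [hj]
      simp [hc.1, hc.2]
    · have : A' i = A i := Function.extend_apply' _ _ _ hi
      simp [this]
  · refine ⟨_, ⟨j (Nat.pair m n), rfl⟩, ?_⟩
    rw [hj]
    simp [hmn]

end IsIndexedIndep

theorem exists_isIndepFamily_mk_eq {κ : Cardinal.{0}} (hκ : Cardinal.aleph0 ≤ κ)
    (hκc : κ ≤ Cardinal.continuum) :
    ∃ B : Set (Set ℕ), IsIndepFamily B ∧ SeparatesPointsFam B ∧ Cardinal.mk B = κ := by
  obtain ⟨S, hS⟩ := Cardinal.le_mk_iff_exists_set.1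
    (show κ ≤ Cardinal.mk (Set ℕ) by simpa [Cardinal.mk_set] using hκc)
  have : Infinite S := Cardinal.infinite_iff.2 (hS ▸ hκ)
  obtain ⟨A, hA, hsep⟩ := ((isIndexedIndep_fichtenholz.preimage_equiv
    (Denumerable.eqv (ℕ × Finset (Finset ℕ))).symm).comp_injective
      (Subtype.val_injective (p := (· ∈ S)))).exists_separatesPointsFam
  exact ⟨Set.range A, hA.isIndepFamily_range, hsep,
    (Cardinal.mk_range_eq A hA.injective).trans hS⟩

end CategoryDichotomy

/-- if ℵ₁ < cov(M), there is an independent family `B` separating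
points such that `nwd(X(B))` fails the Category Dichotomy. -/
theorem stmt19 (h : Cardinal.aleph 1 < covM) :
    ∃ B : Set (Set ℕ), IsIndepFamily B ∧ SeparatesPointsFam B ∧
      ¬ KatetovLE (nwdXB B) nwdQ ∧
      ∀ Y : Set ℕ, Y ∉ nwdXB B → ¬ KatetovLE ED (restrictIdeal (nwdXB B) Y) := by
  obtain ⟨B, hB, hs, hcard⟩ := exists_isIndepFamily_mk_eq (Cardinal.aleph0_le_aleph 1)
    Cardinal.aleph_one_le_continuum
  refine ⟨B, hB, hs, not_katetovLE_nwdXB_nwdQ hB hs fun hc => ?_, fun Y hY =>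
    not_katetovLE_ED_restrictIdeal hB
      ((mk_envSets_le (Cardinal.aleph0_le_aleph 1) hcard.le).trans_lt h) hY⟩
  rw [← Cardinal.le_aleph0_iff_set_countable, hcard] at hc
  exact Cardinal.aleph0_lt_aleph_one.not_ge hc
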